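/- Let r, s, r', s' be nonzero complex numbers with r s^{−1} = r'^{−1} s'. Define ψ : Q × Q → ℂˣ by ψ(μ,ν) = (r' s^{−1})^{⟨μ,ν⟩}; then ψ is a 2-cocycle (indeed a bicharacter) of the abelian group Q, and there is an isomorphism of Q⁺-graded ℂ-algebras from U⁺_{r,s} onto the cocycle deformation (U⁺_{r',s'})^ψ (same underlying graded vector space as U⁺_{r',s'}, with new product x * y = ψ(μ,ν) x y for x of degree μ and y of degree ν) sending e_i to e_i for every i ∈ I. In particular U⁺_{r,s} and U⁺_{r',s'} are 2-cocycle deformations of each other. -/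

import Mathlib

noncomputable section

/-- The q-integer `(m)_v = 1 + v + ⋯ + v^{m-1}`. -/
def qnat {K : Type} [CommRing K] (v : K) (m : ℕ) : K := ∑ i ∈ Finset.range m, v ^ i

/-- The Gaussian binomial coefficient `binom(m,k)_v`, as a polynomial expression in `v`
(defined through the Pascal-type recurrence). -/
def qbinom {K : Type} [CommRing K] (v : K) : ℕ → ℕ → K
  | _, 0 => 1
  | 0, _ + 1 => 0
  | m + 1, k + 1 => qbinom v m k + v ^ (k + 1) * qbinom v m (k + 1)

/-- The Euler (Ringel) form on basis elements: `⟨α_i, α_j⟩ = d_i a_{ij}` if `i < j`,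
`d_i` if `i = j`, and `0` if `i > j`. -/
def eulB {n : ℕ} (a : Fin n → Fin n → ℤ) (d : Fin n → ℤ) (i j : Fin n) : ℤ :=
  if i < j then d i * a i j else if i = j then d i else 0

/-- The Euler form on the root lattice `Q = Fin n → ℤ` (coordinates in the basis `α_i`). -/
def euler {n : ℕ} (a : Fin n → Fin n → ℤ) (d : Fin n → ℤ) (μ ν : Fin n → ℤ) : ℤ :=
  ∑ i, ∑ j, μ i * ν j * eulB a d i j

/-- The coefficient `c^{(k)}_{ij} = (r_i s_i⁻¹)^{k(k-1)/2} r^{k⟨α_j,α_i⟩} s^{-k⟨α_i,α_j⟩}`. -/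
def ccoef {K : Type} [Field K] {n : ℕ} (a : Fin n → Fin n → ℤ) (d : Fin n → ℤ)
    (r s : K) (i j : Fin n) (k : ℕ) : K :=
  (r ^ d i * (s ^ d i)⁻¹) ^ (k * (k - 1) / 2) *
    r ^ ((k : ℤ) * eulB a d j i) * (s ^ ((k : ℤ) * eulB a d i j))⁻¹

/-- The `(r,s)`-Serre element
`∑_{k=0}^{1-a_{ij}} (-1)^k binom(1-a_{ij},k)_{r_i s_i⁻¹} c^{(k)}_{ij} E_i^{1-a_{ij}-k} E_j E_i^k`. -/
def serreElt {K : Type} [Field K] {n : ℕ} (a : Fin n → Fin n → ℤ) (d : Fin n → ℤ)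
    (r s : K) {A : Type} [Ring A] [Algebra K A] (E : Fin n → A) (i j : Fin n) : A :=
  ∑ k ∈ Finset.range ((1 - a i j).toNat + 1),
    ((-1 : K) ^ k * qbinom (r ^ d i * (s ^ d i)⁻¹) ((1 - a i j).toNat) k *
        ccoef a d r s i j k) •
      (E i ^ ((1 - a i j).toNat - k) * E j * E i ^ k)

/-- The defining relations of `U⁺_{r,s}`: the `(r,s)`-Serre relations. -/
inductive SerreRel (K : Type) [Field K] {n : ℕ} (a : Fin n → Fin n → ℤ) (d : Fin n → ℤ)
    (r s : K) : FreeAlgebra K (Fin n) → FreeAlgebra K (Fin n) → Prop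
  | rel (i j : Fin n) (h : i ≠ j) :
      SerreRel K a d r s (serreElt a d r s (FreeAlgebra.ι K) i j) 0

/-- `U⁺_{r,s}`: the algebra generated by the `e_i` subject only to the `(r,s)`-Serre
relations. -/
abbrev Uplus (K : Type) [Field K] {n : ℕ} (a : Fin n → Fin n → ℤ) (d : Fin n → ℤ)
    (r s : K) : Type := RingQuot (SerreRel K a d r s)

/-- The generator `e_i` of `U⁺_{r,s}`. -/
def eP (K : Type) [Field K] {n : ℕ} (a : Fin n → Fin n → ℤ) (d : Fin n → ℤ)
    (r s : K) (i : Fin n) : Uplus K a d r s :=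
  RingQuot.mkAlgHom K (SerreRel K a d r s) (FreeAlgebra.ι K i)

/-- The degree-`μ` homogeneous component of `U⁺_{r,s}` for `μ ∈ Q⁺`: the span of the
monomials in the `e_i` in which `e_i` occurs exactly `μ i` times. -/
def UplusDeg (K : Type) [Field K] {n : ℕ} (a : Fin n → Fin n → ℤ) (d : Fin n → ℤ)
    (r s : K) (μ : Fin n → ℕ) : Submodule K (Uplus K a d r s) :=
  Submodule.span K
    {x | ∃ w : List (Fin n), (∀ i, w.count i = μ i) ∧ x = (w.map (eP K a d r s)).prod}

section QBinomial

variable {K : Type} [Field K]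

theorem qbinom_zero_right (v : K) (m : ℕ) : qbinom v m 0 = 1 := by
  cases m <;> rfl

theorem qbinom_succ_succ (v : K) (m k : ℕ) :
    qbinom v (m + 1) (k + 1) = qbinom v m k + v ^ (k + 1) * qbinom v m (k + 1) := rfl

theorem qbinom_zero_succ (v : K) (k : ℕ) : qbinom v 0 (k + 1) = 0 := rfl

/-- The second Pascal recurrence for Gaussian binomial coefficients. -/
theorem qbinom_succ_succ' {v : K} (hv : v ≠ 0) (m k : ℕ) :
    qbinom v (m + 1) (k + 1) = v ^ ((m : ℤ) - k) * qbinom v m k + qbinom v m (k + 1) := by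
  induction m generalizing k with
  | zero =>
    cases k with
    | zero => simp [qbinom_succ_succ, qbinom_zero_right, qbinom_zero_succ]
    | succ k => simp [qbinom_succ_succ, qbinom_zero_succ]
  | succ m ih =>
    rw [qbinom_succ_succ v (m + 1) k, ih k]
    cases k with
    | zero =>
      have h := qbinom_succ_succ v m 0
      rw [ih 0] at h
      have hp : v ^ (((m + 1 : ℕ) : ℤ) - ((0 : ℕ) : ℤ)) = v * v ^ ((m : ℤ) - ((0 : ℕ) : ℤ)) := by
        rw [← zpow_one_add₀ hv]; congr 1; push_cast; ring
      rw [hp]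
      simp only [qbinom_zero_right] at h ⊢
      linear_combination -h
    | succ k =>
      have hp : v ^ (((m + 1 : ℕ) : ℤ) - ((k + 1 : ℕ) : ℤ)) =
          v * v ^ ((m : ℤ) - ((k + 1 : ℕ) : ℤ)) := by
        rw [← zpow_one_add₀ hv]; congr 1; push_cast; ring
      have hq : v ^ ((m : ℤ) - (k : ℤ)) = v * v ^ ((m : ℤ) - ((k + 1 : ℕ) : ℤ)) := by
        rw [← zpow_one_add₀ hv]; congr 1; push_cast; ring
      have h₁ := ih k
      rw [hq] at h₁
      rw [hp, qbinom_succ_succ v m k]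
      have h₂ := qbinom_succ_succ v m k
      have h₃ := qbinom_succ_succ v m (k + 1)
      rw [ih (k + 1)] at h₃
      linear_combination h₁ - h₂ - h₃

theorem qbinom_inv {v : K} (hv : v ≠ 0) (m k : ℕ) :
    qbinom v⁻¹ m k = v ^ (-((k : ℤ) * (m - k))) * qbinom v m k := by
  induction m generalizing k with
  | zero =>
    cases k with
    | zero => simp [qbinom_zero_right]
    | succ k => simp [qbinom_zero_succ]
  | succ m ih =>
    cases k with
    | zero => simp [qbinom_zero_right]
    | succ k =>
      rw [qbinom_succ_succ, ih, ih, qbinom_succ_succ' hv, mul_add, ← mul_assoc, ← mul_assoc,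
        ← zpow_natCast, inv_zpow', ← zpow_add₀ hv, ← zpow_add₀ hv]
      congr 3 <;> push_cast <;> ring

end QBinomial

section Euler

variable {n : ℕ} (a : Fin n → Fin n → ℤ) (d : Fin n → ℤ)

theorem euler_add_left (μ μ' ν : Fin n → ℤ) :
    euler a d (μ + μ') ν = euler a d μ ν + euler a d μ' ν := by
  simp [euler, add_mul, Finset.sum_add_distrib]

theorem euler_add_right (μ ν ν' : Fin n → ℤ) :
    euler a d μ (ν + ν') = euler a d μ ν + euler a d μ ν' := by
  simp [euler, add_mul, mul_add, Finset.sum_add_distrib]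

theorem euler_zero_left (ν : Fin n → ℤ) : euler a d 0 ν = 0 := by simp [euler]

theorem euler_zero_right (μ : Fin n → ℤ) : euler a d μ 0 = 0 := by simp [euler]

theorem euler_smul_left (c : ℤ) (μ ν : Fin n → ℤ) :
    euler a d (c • μ) ν = c * euler a d μ ν := by
  simp [euler, Finset.mul_sum, mul_assoc]

theorem euler_smul_right (c : ℤ) (μ ν : Fin n → ℤ) :
    euler a d μ (c • ν) = c * euler a d μ ν := by
  simp only [euler, Finset.mul_sum, Pi.smul_apply, smul_eq_mul]
  exact Finset.sum_congr rfl fun i _ => Finset.sum_congr rfl fun j _ => by ring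

theorem euler_single_single (i j : Fin n) :
    euler a d (Pi.single i 1) (Pi.single j 1) = eulB a d i j := by
  simp [euler, Pi.single_apply]

theorem eulB_add_eulB_swap {a : Fin n → Fin n → ℤ} {d : Fin n → ℤ}
    (hsym : ∀ i j, d i * a i j = d j * a j i) {i j : Fin n} (h : i ≠ j) :
    eulB a d i j + eulB a d j i = d i * a i j := by
  rcases lt_or_gt_of_ne h with h' | h'
  · simp [eulB, h', h'.not_gt, h.symm]
  · simp [eulB, h', h'.not_gt, h, hsym i j]

end Euler

section Words

variable {K : Type} [Field K] {n : ℕ} (a : Fin n → Fin n → ℤ) (d : Fin n → ℤ)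

/-- The weight in the root lattice of a word in the simple roots. -/
def wordWeight (w : List (Fin n)) : Fin n → ℤ := fun i => (w.count i : ℤ)

theorem wordWeight_nil : wordWeight ([] : List (Fin n)) = 0 := by
  ext; simp [wordWeight]

theorem wordWeight_cons (i : Fin n) (w : List (Fin n)) :
    wordWeight (i :: w) = Pi.single i 1 + wordWeight w := by
  ext j
  by_cases h : i = j
  · subst h; simp [wordWeight, add_comm]
  · simp [wordWeight, h, Ne.symm h]

theorem wordWeight_append (w w' : List (Fin n)) :
    wordWeight (w ++ w') = wordWeight w + wordWeight w' := by
  ext; simp [wordWeight]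

theorem wordWeight_replicate (k : ℕ) (i : Fin n) :
    wordWeight (List.replicate k i) = (k : ℤ) • Pi.single i 1 := by
  induction k with
  | zero => simp [wordWeight_nil]
  | succ k ih =>
    rw [List.replicate_succ, wordWeight_cons, ih]
    push_cast
    rw [add_smul, one_smul, add_comm]

/-- The scalar by which the product of the word `w` in the deformation along
`ψ(μ,ν) = t ^ ⟨μ,ν⟩` differs from its product in the original algebra. -/
def wordTwist (t : K) : List (Fin n) → K
  | [] => 1
  | i :: w => t ^ euler a d (Pi.single i 1) (wordWeight w) * wordTwist t w

variable {t : K}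

theorem wordTwist_ne_zero (ht : t ≠ 0) (w : List (Fin n)) : wordTwist a d t w ≠ 0 := by
  induction w with
  | nil => exact one_ne_zero
  | cons i w ih => exact mul_ne_zero (zpow_ne_zero _ ht) ih

theorem wordTwist_inv (w : List (Fin n)) :
    wordTwist a d t⁻¹ w = (wordTwist a d t w)⁻¹ := by
  induction w with
  | nil => simp [wordTwist]
  | cons i w ih => simp [wordTwist, ih, mul_comm]

theorem wordTwist_append (ht : t ≠ 0) (w w' : List (Fin n)) :
    wordTwist a d t (w ++ w') =
      t ^ euler a d (wordWeight w) (wordWeight w') * (wordTwist a d t w * wordTwist a d t w') := by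
  induction w with
  | nil => simp [wordTwist, wordWeight_nil, euler_zero_left]
  | cons i w ih =>
    simp only [List.cons_append, wordTwist, ih, wordWeight_append, wordWeight_cons,
      euler_add_left, euler_add_right, zpow_add₀ ht]
    ring

theorem wordTwist_replicate_append_cons_replicate (ht : t ≠ 0) (i j : Fin n) (k l : ℕ) :
    wordTwist a d t (List.replicate l i ++ j :: List.replicate k i) =
      t ^ ((l : ℤ) * eulB a d i j + k * eulB a d j i) *
        wordTwist a d t (List.replicate (l + k) i) := by
  rw [List.replicate_add, wordTwist_append a d ht, wordTwist_append a d ht]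
  simp only [wordTwist, wordWeight_cons, wordWeight_replicate, euler_add_right, euler_smul_left,
    euler_smul_right, euler_single_single, zpow_add₀ ht]
  ring

theorem wordWeight_replicate_append_cons_replicate (i j : Fin n) (k l : ℕ) :
    wordWeight (List.replicate l i ++ j :: List.replicate k i) =
      ((l + k : ℕ) : ℤ) • Pi.single i 1 + Pi.single j 1 := by
  rw [wordWeight_append, wordWeight_cons, wordWeight_replicate, wordWeight_replicate]
  push_cast
  rw [add_smul]
  abel

end Words

section Deformation

variable {K : Type} [Field K] {n : ℕ} (a : Fin n → Fin n → ℤ) (d : Fin n → ℤ)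

theorem map_serreElt {A B : Type} [Ring A] [Algebra K A] [Ring B] [Algebra K B] (r s : K)
    (φ : A →ₐ[K] B) (E : Fin n → A) (i j : Fin n) :
    φ (serreElt a d r s E i j) = serreElt a d r s (fun i => φ (E i)) i j := by
  simp [serreElt]

theorem serreElt_eP (r s : K) {i j : Fin n} (h : i ≠ j) :
    serreElt a d r s (eP K a d r s) i j = 0 := by
  have := RingQuot.mkAlgHom_rel K (SerreRel.rel (K := K) (a := a) (d := d) (r := r) (s := s) i j h)
  rwa [map_serreElt, map_zero] at this

theorem span_words_eq_top (r s : K) :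
    Submodule.span K (Set.range fun w : List (Fin n) => (w.map (eP K a d r s)).prod) = ⊤ := by
  have hadj : Algebra.adjoin K (Set.range (eP K a d r s)) = ⊤ := by
    have hrange : Set.range (eP K a d r s) =
        RingQuot.mkAlgHom K (SerreRel K a d r s) '' Set.range (FreeAlgebra.ι K) := by
      rw [← Set.range_comp]; rfl
    rw [hrange, ← AlgHom.map_adjoin, FreeAlgebra.adjoin_range_ι, Algebra.map_top,
      AlgHom.range_eq_top]
    exact RingQuot.mkAlgHom_surjective K _
  rw [eq_top_iff, ← Algebra.top_toSubmodule, ← hadj, Algebra.adjoin_eq_span]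
  refine Submodule.span_mono fun x hx => ?_
  induction hx using Submonoid.closure_induction with
  | mem x hx => obtain ⟨i, rfl⟩ := hx; exact ⟨[i], by simp⟩
  | one => exact ⟨[], by simp⟩
  | mul x y _ _ hx hy =>
    obtain ⟨w, rfl⟩ := hx
    obtain ⟨w', rfl⟩ := hy
    exact ⟨w ++ w', by simp⟩

variable {a d}

theorem eq_of_ratio_eq_inv {r s r' s' : K} (hs : s ≠ 0) (hr' : r' ≠ 0)
    (hpar : r * s⁻¹ = r'⁻¹ * s') : s' = r * r' * s⁻¹ := by
  field_simp at hpar ⊢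
  linear_combination -hpar

/-- Up to a scalar independent of `k`, twisting turns the coefficients of the `(r,s)`-Serre element
into those of the `(r',s')`-Serre element. -/
theorem serre_coeff_twist (hsym : ∀ i j, d i * a i j = d j * a j i)
    {r s r' s' : K} (hr : r ≠ 0) (hs : s ≠ 0) (hr' : r' ≠ 0)
    (hpar : r * s⁻¹ = r'⁻¹ * s') {i j : Fin n} (hij : i ≠ j) {m k l : ℕ}
    (hm : (m : ℤ) = 1 - a i j) (hkl : l + k = m) :
    qbinom (r ^ d i * (s ^ d i)⁻¹) m k * ccoef a d r s i j k *
        (r' * s⁻¹) ^ ((l : ℤ) * eulB a d i j + k * eulB a d j i) =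
      (r' * s⁻¹) ^ ((m : ℤ) * eulB a d i j) *
        (qbinom (r' ^ d i * (s' ^ d i)⁻¹) m k * ccoef a d r' s' i j k) := by
  have hs' := eq_of_ratio_eq_inv hs hr' hpar
  have hV : r ^ d i * (s ^ d i)⁻¹ ≠ 0 := by positivity
  have hV' : r' ^ d i * (s' ^ d i)⁻¹ = (r ^ d i * (s ^ d i)⁻¹)⁻¹ := by
    rw [hs', mul_zpow, mul_zpow, inv_zpow]
    field_simp
  obtain ⟨N, hN⟩ : ∃ N : ℕ, k * (k - 1) / 2 = N := ⟨_, rfl⟩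
  have hN2 : 2 * (N : ℤ) = k * (k - 1) := by
    have h := Nat.div_mul_cancel (Nat.even_mul_pred_self k).two_dvd
    rw [hN] at h
    cases k with
    | zero => simp at h; simp [h]
    | succ k => simp at h; push_cast; simp; exact_mod_cast (by linarith)
  have hsum := eulB_add_eulB_swap hsym hij
  unfold ccoef
  rw [hV', qbinom_inv hV, hN]
  generalize qbinom (r ^ d i * (s ^ d i)⁻¹) m k = b
  generalize eulB a d i j = x at *
  generalize eulB a d j i = y at *
  have hlm : (l : ℤ) = m - k := by rw [← hkl]; push_cast; ring
  have hexp : d i * N + k * y = -(d i * (k * (m - k))) + -(d i * N) + -(k * x) := by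
    linear_combination d i * hN2 + k * hsum + (k : ℤ) * d i * hm
  calc
    _ = b * (r ^ (d i * N + k * y) * s ^ (-(d i * N) + -(k * x) + -(l * x + k * y)) *
          r' ^ (l * x + k * y)) := by
      simp only [zpow_add₀ hr, zpow_add₀ hs, zpow_add₀ hr', zpow_neg, mul_zpow, inv_zpow,
        ← zpow_natCast, ← zpow_mul, mul_inv]
      ring
    _ = b * (r ^ (-(d i * (k * (m - k))) + -(d i * N) + -(k * x)) *
          s ^ (d i * (k * (m - k)) + d i * N + k * x + -(m * x)) *
          r' ^ (m * x + k * y + -(k * x))) := by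
      have hsexp : -(d i * N) + -(k * x) + -(l * x + k * y) =
          d i * (k * (m - k)) + d i * N + k * x + -(m * x) := by
        rw [hlm]; linear_combination -hexp
      have hrexp : l * x + k * y = m * x + k * y + -(k * x) := by rw [hlm]; ring
      rw [hexp, hsexp, hrexp]
    _ = _ := by
      rw [hs']
      simp only [zpow_add₀ hr, zpow_add₀ hs, zpow_add₀ hr', zpow_neg, mul_zpow, inv_zpow,
        inv_inv, ← zpow_natCast, ← zpow_mul, mul_inv]
      ring

/-- Left multiplication by `e_i` in the deformed algebra, acting on functions on the root
lattice with values in the original algebra. -/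
def twistedMul {A : Type} [Ring A] [Algebra K A] (a : Fin n → Fin n → ℤ) (d : Fin n → ℤ) (t : K)
    (E : Fin n → A) (i : Fin n) : Module.End K ((Fin n → ℤ) → A) where
  toFun f μ := t ^ euler a d μ (Pi.single i 1) • (E i * f (μ + Pi.single i 1))
  map_add' f g := by ext μ; simp [mul_add]
  map_smul' c f := by ext μ; simp [smul_comm c]

theorem prod_map_twistedMul {A : Type} [Ring A] [Algebra K A] {t : K} (ht : t ≠ 0)
    (E : Fin n → A) (w : List (Fin n)) (f : (Fin n → ℤ) → A) (μ : Fin n → ℤ) :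
    (w.map (twistedMul a d t E)).prod f μ =
      (t ^ euler a d μ (wordWeight w) * wordTwist a d t w) •
        ((w.map E).prod * f (μ + wordWeight w)) := by
  induction w generalizing μ with
  | nil => simp [wordTwist, wordWeight_nil, euler_zero_right]
  | cons i w ih =>
    simp only [List.map_cons, List.prod_cons, Module.End.mul_apply]
    change t ^ euler a d μ (Pi.single i 1) • (E i * _) = _
    rw [ih]
    simp only [mul_smul_comm, smul_smul, mul_assoc, wordTwist, wordWeight_cons, add_assoc,
      euler_add_left, euler_add_right, zpow_add₀ ht]

theorem pow_mul_mul_pow_eq_prod {A : Type} [Ring A] (E : Fin n → A) (i j : Fin n) (k l : ℕ) :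
    E i ^ l * E j * E i ^ k =
      ((List.replicate l i ++ j :: List.replicate k i).map E).prod := by
  simp [mul_assoc]

theorem serreElt_twistedMul (hoff : ∀ i j, i ≠ j → a i j ≤ 0)
    (hsym : ∀ i j, d i * a i j = d j * a j i)
    {r s r' s' : K} (hr : r ≠ 0) (hs : s ≠ 0) (hr' : r' ≠ 0)
    (hpar : r * s⁻¹ = r'⁻¹ * s') {A : Type} [Ring A] [Algebra K A] (E : Fin n → A)
    {i j : Fin n} (hij : i ≠ j) (hE : serreElt a d r' s' E i j = 0) :
    serreElt a d r s (twistedMul a d (r' * s⁻¹) E) i j = 0 := by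
  have ht : r' * s⁻¹ ≠ 0 := mul_ne_zero hr' (inv_ne_zero hs)
  have hm : ((1 - a i j).toNat : ℤ) = 1 - a i j :=
    Int.toNat_of_nonneg (by linarith [hoff i j hij])
  refine LinearMap.ext fun f => funext fun μ => ?_
  unfold serreElt at hE ⊢
  generalize (1 - a i j).toNat = m at *
  set lam : Fin n → ℤ := (m : ℤ) • Pi.single i 1 + Pi.single j 1 with hlam
  set c : K := (r' * s⁻¹) ^ euler a d μ lam * wordTwist a d (r' * s⁻¹) (List.replicate m i) *
    (r' * s⁻¹) ^ ((m : ℤ) * eulB a d i j) with hc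
  have key := congrArg (fun z => c • (z * f (μ + lam))) hE
  simp only [zero_mul, smul_zero, Finset.sum_mul, Finset.smul_sum] at key
  rw [LinearMap.sum_apply, Finset.sum_apply, LinearMap.zero_apply, Pi.zero_apply, ← key]
  refine Finset.sum_congr rfl fun k hk => ?_
  have hkm : m - k + k = m := Nat.sub_add_cancel (Nat.lt_succ_iff.mp (Finset.mem_range.mp hk))
  rw [pow_mul_mul_pow_eq_prod, pow_mul_mul_pow_eq_prod, LinearMap.smul_apply, Pi.smul_apply,
    prod_map_twistedMul ht, wordTwist_replicate_append_cons_replicate a d ht,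
    wordWeight_replicate_append_cons_replicate, hkm, ← hlam, smul_mul_assoc, smul_smul, smul_smul]
  congr 1
  rw [hc]
  linear_combination ((-1) ^ k * (r' * s⁻¹) ^ euler a d μ lam *
    wordTwist a d (r' * s⁻¹) (List.replicate m i)) *
    serre_coeff_twist hsym hr hs hr' hpar hij hm hkm

/-- There is a linear map `U⁺_{r,s} → U⁺_{r',s'}` rescaling each word by its twist. -/
theorem exists_twist_linearMap (hoff : ∀ i j, i ≠ j → a i j ≤ 0)
    (hsym : ∀ i j, d i * a i j = d j * a j i)
    {r s r' s' : K} (hr : r ≠ 0) (hs : s ≠ 0) (hr' : r' ≠ 0)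
    (hpar : r * s⁻¹ = r'⁻¹ * s') :
    ∃ φ : Uplus K a d r s →ₗ[K] Uplus K a d r' s', ∀ w : List (Fin n),
      φ (w.map (eP K a d r s)).prod =
        wordTwist a d (r' * s⁻¹) w • (w.map (eP K a d r' s')).prod := by
  have ht : r' * s⁻¹ ≠ 0 := mul_ne_zero hr' (inv_ne_zero hs)
  let L := twistedMul a d (r' * s⁻¹) (eP K a d r' s')
  let F : Uplus K a d r s →ₐ[K] Module.End K ((Fin n → ℤ) → Uplus K a d r' s') :=
    RingQuot.liftAlgHom K ⟨FreeAlgebra.lift K L, fun {x y} h => by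
      obtain ⟨i, j, hij⟩ := h
      rw [map_zero]
      refine (map_serreElt a d r s (FreeAlgebra.lift K L) _ i j).trans ?_
      simp only [FreeAlgebra.lift_ι_apply]
      exact serreElt_twistedMul hoff hsym hr hs hr' hpar _ hij (serreElt_eP a d r' s' hij)⟩
  have hF : ∀ i, F (eP K a d r s i) = L i := fun i => by
    simp [F, eP]
  refine ⟨LinearMap.proj 0 ∘ₗ LinearMap.applyₗ 1 ∘ₗ F.toLinearMap, fun w => ?_⟩
  have hw : F (w.map (eP K a d r s)).prod = (w.map L).prod := by
    rw [map_list_prod, List.map_map]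
    congr 2
    exact funext hF
  change F (w.map (eP K a d r s)).prod 1 0 = _
  rw [hw, prod_map_twistedMul ht]
  simp [euler_zero_left]

theorem exists_twist_linearEquiv (hoff : ∀ i j, i ≠ j → a i j ≤ 0)
    (hsym : ∀ i j, d i * a i j = d j * a j i)
    {r s r' s' : K} (hr : r ≠ 0) (hs : s ≠ 0) (hr' : r' ≠ 0) (hs' : s' ≠ 0)
    (hpar : r * s⁻¹ = r'⁻¹ * s') :
    ∃ Φ : Uplus K a d r s ≃ₗ[K] Uplus K a d r' s', ∀ w : List (Fin n),
      Φ (w.map (eP K a d r s)).prod =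
        wordTwist a d (r' * s⁻¹) w • (w.map (eP K a d r' s')).prod := by
  have ht : r' * s⁻¹ ≠ 0 := mul_ne_zero hr' (inv_ne_zero hs)
  have hinv : r * s'⁻¹ = (r' * s⁻¹)⁻¹ := by
    rw [eq_of_ratio_eq_inv hs hr' hpar]; field_simp
  have hpar' : r' * s'⁻¹ = r⁻¹ * s := by
    rw [eq_of_ratio_eq_inv hs hr' hpar]; field_simp
  obtain ⟨φ, hφ⟩ := exists_twist_linearMap hoff hsym hr hs hr' hpar
  obtain ⟨χ, hχ⟩ := exists_twist_linearMap hoff hsym hr' hs' hr hpar'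
  rw [hinv] at hχ
  refine ⟨LinearEquiv.ofLinearMap φ χ ?_ ?_, hφ⟩
  · refine LinearMap.ext_on_range (span_words_eq_top a d r' s') fun w => ?_
    simp only [LinearMap.comp_apply, LinearMap.id_apply, map_smul, hφ, hχ, wordTwist_inv]
    rw [smul_smul, inv_mul_cancel₀ (wordTwist_ne_zero a d ht w), one_smul]
  · refine LinearMap.ext_on_range (span_words_eq_top a d r s) fun w => ?_
    simp only [LinearMap.comp_apply, LinearMap.id_apply, map_smul, hφ, hχ, wordTwist_inv]
    rw [smul_smul, mul_inv_cancel₀ (wordTwist_ne_zero a d ht w), one_smul]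

end Deformation

/-- **Theorem 3.2(II).** If `r s⁻¹ = r'⁻¹ s'` (all parameters nonzero complex numbers), then
`ψ(μ,ν) = (r' s⁻¹)^{⟨μ,ν⟩}` is a 2-cocycle (indeed a bicharacter) of the root lattice `Q`,
and `e_i ↦ e_i` gives an isomorphism of `Q⁺`-graded `ℂ`-algebras from `U⁺_{r,s}` onto the
cocycle deformation `(U⁺_{r',s'})^ψ`; in particular `U⁺_{r,s}` and `U⁺_{r',s'}` are
2-cocycle deformations of each other. -/
theorem Uplus_cocycle_deformation_of_ratio_eq_inv
    (n : ℕ) (a : Fin n → Fin n → ℤ) (d : Fin n → ℤ)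
    (hdiag : ∀ i, a i i = 2) (hoff : ∀ i j, i ≠ j → a i j ≤ 0)
    (hsym : ∀ i j, d i * a i j = d j * a j i) (hdpos : ∀ i, 0 < d i)
    (hfin : Matrix.PosDef (Matrix.of fun i j : Fin n => ((d i * a i j : ℤ) : ℝ)))
    (r s r' s' : ℂ) (hr : r ≠ 0) (hs : s ≠ 0) (hr' : r' ≠ 0) (hs' : s' ≠ 0)
    (hpar : r * s⁻¹ = r'⁻¹ * s') :
    (∀ μ ν lam : Fin n → ℤ,
        (r' * s⁻¹) ^ euler a d μ ν * (r' * s⁻¹) ^ euler a d (μ + ν) lam =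
          (r' * s⁻¹) ^ euler a d ν lam * (r' * s⁻¹) ^ euler a d μ (ν + lam)) ∧
    (∀ μ μ' ν : Fin n → ℤ,
        (r' * s⁻¹) ^ euler a d (μ + μ') ν =
          (r' * s⁻¹) ^ euler a d μ ν * (r' * s⁻¹) ^ euler a d μ' ν) ∧
    (∀ μ ν ν' : Fin n → ℤ,
        (r' * s⁻¹) ^ euler a d μ (ν + ν') =
          (r' * s⁻¹) ^ euler a d μ ν * (r' * s⁻¹) ^ euler a d μ ν') ∧
    ∃ Φ : Uplus ℂ a d r s ≃ₗ[ℂ] Uplus ℂ a d r' s',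
      (∀ i, Φ (eP ℂ a d r s i) = eP ℂ a d r' s' i) ∧
      Φ 1 = 1 ∧
      (∀ (μ ν : Fin n → ℕ) (x y : Uplus ℂ a d r s),
          x ∈ UplusDeg ℂ a d r s μ → y ∈ UplusDeg ℂ a d r s ν →
          Φ (x * y) =
            ((r' * s⁻¹) ^ euler a d (fun i => (μ i : ℤ)) (fun i => (ν i : ℤ))) •
              (Φ x * Φ y)) ∧
      (∀ μ : Fin n → ℕ,
          Submodule.map Φ.toLinearMap (UplusDeg ℂ a d r s μ) = UplusDeg ℂ a d r' s' μ) := by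
  have ht : r' * s⁻¹ ≠ 0 := mul_ne_zero hr' (inv_ne_zero hs)
  refine ⟨fun μ ν lam => ?_, fun μ μ' ν => ?_, fun μ ν ν' => ?_, ?_⟩
  · rw [euler_add_left, euler_add_right, zpow_add₀ ht, zpow_add₀ ht]
    ring
  · rw [euler_add_left, zpow_add₀ ht]
  · rw [euler_add_right, zpow_add₀ ht]
  obtain ⟨Φ, hΦ⟩ := exists_twist_linearEquiv hoff hsym hr hs hr' hs' hpar
  refine ⟨Φ, fun i => ?_, ?_, fun μ ν x y hx hy => ?_, fun μ => ?_⟩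
  · simpa [wordTwist, wordWeight_nil, euler_zero_right] using hΦ [i]
  · simpa [wordTwist] using hΦ []
  · unfold UplusDeg at hx hy
    induction hx, hy using Submodule.span_induction₂ with
    | mem_mem x y hx hy =>
      obtain ⟨w, hw, rfl⟩ := hx
      obtain ⟨w', hw', rfl⟩ := hy
      have hμ : (fun i => (μ i : ℤ)) = wordWeight w := by ext i; simp [wordWeight, hw]
      have hν : (fun i => (ν i : ℤ)) = wordWeight w' := by ext i; simp [wordWeight, hw']
      rw [← List.prod_append, ← List.map_append, hΦ, hΦ, hΦ, hμ, hν, wordTwist_append a d ht,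
        List.map_append, List.prod_append, smul_mul_smul_comm, smul_smul]
    | zero_left y _ => simp
    | zero_right x _ => simp
    | add_left x x' y _ _ _ hx hx' => simp only [add_mul, map_add, hx, hx', smul_add]
    | add_right x y y' _ _ _ hy hy' => simp only [mul_add, map_add, hy, hy', smul_add]
    | smul_left c x y _ _ h => rw [smul_mul_assoc, map_smul, h, map_smul, smul_mul_assoc, smul_comm]
    | smul_right c x y _ _ h => rw [mul_smul_comm, map_smul, h, map_smul, mul_smul_comm, smul_comm]
  · unfold UplusDeg
    apply le_antisymm
    · rw [Submodule.map_span_le]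
      rintro _ ⟨w, hw, rfl⟩
      change Φ _ ∈ _
      rw [hΦ]
      exact Submodule.smul_mem _ _ (Submodule.subset_span ⟨w, hw, rfl⟩)
    · rw [Submodule.span_le]
      rintro _ ⟨w, hw, rfl⟩
      refine ⟨(wordTwist a d (r' * s⁻¹) w)⁻¹ • (w.map (eP ℂ a d r s)).prod,
        Submodule.smul_mem _ _ (Submodule.subset_span ⟨w, hw, rfl⟩), ?_⟩
      change Φ _ = _
      rw [map_smul, hΦ, smul_smul, inv_mul_cancel₀ (wordTwist_ne_zero a d ht w), one_smul]

end
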